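/- Let K be a field, Γ a subgroup of the multiplicative group K^×, and R an associative unital K-algebra which is a domain. Let 1 ≤ i ≤ n and let x_1, …, x_n ∈ R be such that x_{i+1}, …, x_n are invertible in R, and suppose: (a) the monomials x_1^{m_1} ⋯ x_i^{m_i} x_{i+1}^{m_{i+1}} ⋯ x_n^{m_n}, with m_1, …, m_i ∈ ℕ and m_{i+1}, …, m_n ∈ ℤ, form a K-basis of R; (b) for every j with i+1 ≤ j ≤ n and every l with 1 ≤ l ≤ n there exists q ∈ Γ with x_j x_l = q·x_l x_j; (c) for all j < s ≤ i there exists q_{js} ∈ Γ such that x_j x_s − q_{js}·x_s x_j lies in the K-subalgebra of R generated by x_{j+1}, …, x_i and x_{i+1}^{±1}, …, x_n^{±1}. Then x = x_i is an FA-element of R, and moreover for every y ∈ R there exist N ∈ ℕ and β_1, …, β_N ∈ Γ such that, writing c_0, …, c_N ∈ K for the coefficients of the polynomial f(t) = (t − β_1)⋯(t − β_N) (so c_k is the coefficient of t^k), one has Σ_{k=0}^{N} c_k · x^k y x^{N−k} = 0 in R. -/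

import Mathlib

/-- `FAP Γ x y`: some product of operators `y ↦ x y - β y x`, `β ∈ Γ`, kills `y`. -/
inductive FAP {K R : Type*} [Field K] [Ring R] [Algebra K R] (Γ : Subgroup Kˣ) (x : R) : R → Prop
  | zero : FAP Γ x 0
  | step (β : Γ) (y : R) : FAP Γ x (x * y - ((β : Kˣ) : K) • (y * x)) → FAP Γ x y

section FAPsection
variable {K R : Type*} [Field K] [Ring R] [Algebra K R] {Γ : Subgroup Kˣ} {x : R}

theorem FAP.dd {y : R} (h : FAP Γ x y) (γ : K) : FAP Γ x (x * y - γ • (y * x)) := by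
  induction h with
  | zero => simpa using FAP.zero
  | step β y _ ih =>
    refine FAP.step β _ ?_
    convert ih using 1
    simp only [mul_sub, sub_mul, smul_sub, mul_smul_comm, smul_mul_assoc, mul_assoc,
      smul_comm γ ((β : Kˣ) : K)]
    abel

theorem FAP.smul {y : R} (h : FAP Γ x y) (γ : K) : FAP Γ x (γ • y) := by
  induction h with
  | zero => simpa using FAP.zero
  | step β y _ ih =>
    refine FAP.step β _ ?_
    convert ih using 1
    simp only [smul_sub, mul_smul_comm, smul_mul_assoc, smul_comm γ ((β : Kˣ) : K)]

theorem FAP.add {y : R} (h : FAP Γ x y) : ∀ {z : R}, FAP Γ x z → FAP Γ x (y + z) := by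
  induction h with
  | zero => intro z hz; simpa using hz
  | step β y _ ih =>
    intro z hz
    refine FAP.step β _ ?_
    convert ih (hz.dd ((β : Kˣ) : K)) using 1
    simp only [mul_add, add_mul, smul_add]
    abel

theorem FAP.mul {y : R} (h : FAP Γ x y) : ∀ {z : R}, FAP Γ x z → FAP Γ x (y * z) := by
  induction h with
  | zero => intro z _; simpa using FAP.zero
  | step β y _ ih =>
    intro z hz
    induction hz with
    | zero => simpa using FAP.zero
    | step γ z hz' ih2 =>
      refine FAP.step (β * γ) _ ?_
      convert (ih (FAP.step γ z hz')).add (ih2.smul ((β : Kˣ) : K)) using 1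
      simp only [mul_sub, sub_mul, smul_sub, mul_smul_comm, smul_mul_assoc, mul_assoc,
        Subgroup.coe_mul, Units.val_mul, mul_smul]
      abel

theorem FAP.of_semi {y : R} (β : Γ) (h : x * y = ((β : Kˣ) : K) • (y * x)) : FAP Γ x y :=
  FAP.step β y (by rw [h, sub_self]; exact FAP.zero)

theorem FAP.of_semi' {y : R} (β : Γ) (h : y * x = ((β : Kˣ) : K) • (x * y)) : FAP Γ x y :=
  FAP.of_semi β⁻¹ (by rw [h, smul_smul]; simp)

theorem FAP.alg (γ : K) : FAP Γ x (algebraMap K R γ) :=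
  FAP.of_semi 1 (by simp [Algebra.commutes])

/-- The elements killed form a subalgebra. -/
def FAP.sub (Γ : Subgroup Kˣ) (x : R) : Subalgebra K R where
  carrier := {y | FAP Γ x y}
  mul_mem' h h' := FAP.mul h h'
  add_mem' h h' := FAP.add h h'
  algebraMap_mem' γ := FAP.alg γ

theorem FAP.final {y : R} (h : FAP Γ x y) : ∃ (N : ℕ) (β : Fin N → Γ),
      ∑ k ∈ Finset.range (N + 1),
        (∏ m : Fin N, (Polynomial.X - Polynomial.C (((β m : Kˣ) : K)))).coeff k •
          (x ^ k * y * x ^ (N - k)) = 0 := by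
  induction h with
  | zero => exact ⟨0, Fin.elim0, by simp⟩
  | step γ y _ ih =>
    obtain ⟨N, β, h⟩ := ih
    refine ⟨N + 1, Fin.cons γ β, ?_⟩
    rw [Fin.prod_univ_succ]
    simp only [Fin.cons_zero, Fin.cons_succ]
    have hd : (∏ m : Fin N, (Polynomial.X - Polynomial.C (((β m : Kˣ) : K)))).natDegree ≤ N := by
      simp
    generalize (∏ m : Fin N, (Polynomial.X - Polynomial.C (((β m : Kˣ) : K)))) = f at h hd
    simp only [sub_mul, Polynomial.coeff_sub, Polynomial.coeff_C_mul, sub_smul,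
      Finset.sum_sub_distrib]
    rw [Finset.sum_range_succ', Finset.sum_range_succ (n := N + 1),
      Polynomial.coeff_eq_zero_of_natDegree_lt (p := f) (n := N + 1) (by omega)]
    simp only [Polynomial.coeff_X_mul, Polynomial.coeff_X_mul_zero, zero_smul, mul_zero, add_zero]
    rw [← h, ← Finset.sum_sub_distrib]
    refine Finset.sum_congr rfl fun k hk => ?_
    have hk' : N + 1 - k = (N - k) + 1 := by have := Finset.mem_range.1 hk; omega
    rw [hk', Nat.add_sub_add_right, pow_succ x k, pow_succ' x (N - k)]
    simp only [mul_sub, sub_mul, smul_sub, mul_smul_comm, smul_mul_assoc, mul_assoc, mul_smul]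
    rw [smul_comm (f.coeff k)]

end FAPsection


/-- Lemma 4.3: let `K` be a field, `Γ ≤ Kˣ` a subgroup, and `R` a `K`-algebra
which is a domain, with elements `x 0, …, x (n-1)` (representing
`x_1, …, x_n`), the last `n - i` of which are invertible (witnessed by units
`u j` with `↑(u j) = x j` for `i ≤ j`). Assume:
(a) the ordered monomials `x_1^{m_1} ⋯ x_i^{m_i} x_{i+1}^{±m_{i+1}} ⋯ x_n^{±m_n}`
    (with `m_j ∈ ℕ` for `j ≤ i` and `m_j ∈ ℤ` for `j > i`) form a `K`-basis of `R`;
(b) each of `x_{i+1}, …, x_n` semicommutes (with factor in `Γ`) with every generator;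
(c) for `j < s ≤ i` there is `q_{js} ∈ Γ` with `x_j x_s - q_{js} x_s x_j` in the
    `K`-subalgebra generated by `x_{j+1}, …, x_i, x_{i+1}^{±1}, …, x_n^{±1}`.
Then `x_i` is an FA-element of `R`: it is not a zero divisor and for every
`y ∈ R` there is a polynomial `f(t) = (t - β_1)⋯(t - β_N)` with roots in `Γ`
such that `∑_{k=0}^{N} c_k x_i^k y x_i^{N-k} = 0`, `c_k` the coefficients of `f`. -/
theorem fa_element_in_localized_Q_solvable_algebra
    {K R : Type*} [Field K] [Ring R] [IsDomain R] [Algebra K R]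
    (Γ : Subgroup Kˣ) (n i : ℕ) (hi1 : 1 ≤ i) (hin : i ≤ n)
    (x : Fin n → R) (u : Fin n → Rˣ)
    (hu : ∀ j : Fin n, i ≤ (j : ℕ) → ((u j : R) = x j))
    (mono : {m : Fin n → ℤ // ∀ j : Fin n, (j : ℕ) < i → 0 ≤ m j} → R)
    (hmono : ∀ m, mono m =
      (((List.finRange n).map (fun j : Fin n =>
        if (j : ℕ) < i then x j ^ (m.1 j).toNat
        else ((u j ^ (m.1 j) : Rˣ) : R))).prod))
    (hbasis_li : LinearIndependent K mono)
    (hbasis_span : Submodule.span K (Set.range mono) = ⊤)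
    (hsemicomm : ∀ j l : Fin n, i ≤ (j : ℕ) →
      ∃ q : Γ, x j * x l = ((q : Kˣ) : K) • (x l * x j))
    (hrel : ∀ j s : Fin n, (j : ℕ) < (s : ℕ) → (s : ℕ) < i →
      ∃ q : Γ, x j * x s - ((q : Kˣ) : K) • (x s * x j) ∈
        Algebra.adjoin K
          ({r : R | ∃ t : Fin n, (j : ℕ) < (t : ℕ) ∧ r = x t} ∪
           {r : R | ∃ t : Fin n, i ≤ (t : ℕ) ∧ r = (((u t)⁻¹ : Rˣ) : R)}))
    (xi : Fin n) (hxi : (xi : ℕ) + 1 = i) :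
    (∀ r : R, x xi * r = 0 → r = 0) ∧
    (∀ r : R, r * x xi = 0 → r = 0) ∧
    (∀ y : R, ∃ (N : ℕ) (β : Fin N → Γ),
      ∑ k ∈ Finset.range (N + 1),
        (∏ m : Fin N, (Polynomial.X - Polynomial.C (((β m : Kˣ) : K)))).coeff k •
          (x xi ^ k * y * x xi ^ (N - k)) = 0) := by

  have hne : x xi ≠ 0 := by
    intro h0
    let m : {m : Fin n → ℤ // ∀ j : Fin n, (j : ℕ) < i → 0 ≤ m j} := ⟨fun _ => 1, by simp⟩
    refine hbasis_li.ne_zero m ?_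
    rw [hmono]
    refine List.prod_eq_zero (List.mem_map.2 ⟨xi, List.mem_finRange _, ?_⟩)
    rw [if_pos (by omega)]
    simp [m, h0]
  refine ⟨fun r h => (mul_eq_zero.1 h).resolve_left hne,
    fun r h => (mul_eq_zero.1 h).resolve_right hne, fun y => FAP.final ?_⟩
  have hinv : ∀ t : Fin n, i ≤ (t : ℕ) → (((u t)⁻¹ : Rˣ) : R) ∈ FAP.sub Γ (x xi) := by
    intro t ht
    obtain ⟨q, hq⟩ := hsemicomm t xi ht
    refine FAP.of_semi q ?_
    rw [← hu t ht] at hq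
    have h2 := congrArg (fun z => (((u t)⁻¹ : Rˣ) : R) * z * (((u t)⁻¹ : Rˣ) : R)) hq
    simpa [mul_assoc] using h2
  have hx : ∀ d : ℕ, ∀ j : Fin n, n - (j : ℕ) = d → x j ∈ FAP.sub Γ (x xi) := by
    intro d
    induction d using Nat.strong_induction_on with
    | _ d ih =>
      intro j hj
      rcases lt_trichotomy (j : ℕ) (xi : ℕ) with h | h | h
      · obtain ⟨q, hq⟩ := hrel j xi h (by omega)
        have hle : Algebra.adjoin K
          ({r : R | ∃ t : Fin n, (j : ℕ) < (t : ℕ) ∧ r = x t} ∪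
           {r : R | ∃ t : Fin n, i ≤ (t : ℕ) ∧ r = (((u t)⁻¹ : Rˣ) : R)})
            ≤ FAP.sub Γ (x xi) := by
          refine Algebra.adjoin_le ?_
          rintro r (⟨t, ht, rfl⟩ | ⟨t, ht, rfl⟩)
          · exact ih (n - t) (by omega) t rfl
          · exact hinv t ht
        have h3 : FAP Γ (x xi) _ := hle hq
        refine FAP.step q⁻¹ _ ?_
        convert h3.smul (-(((q⁻¹ : Γ) : Kˣ) : K)) using 1
        rw [smul_sub, smul_smul]
        simp
        abel
      · have : j = xi := Fin.ext h
        subst this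
        exact FAP.of_semi 1 (by simp)
      · obtain ⟨q, hq⟩ := hsemicomm j xi (by omega)
        exact FAP.of_semi' q hq
  have htop : (⊤ : Submodule K R) ≤ Subalgebra.toSubmodule (FAP.sub Γ (x xi)) := by
    rw [← hbasis_span, Submodule.span_le]
    rintro _ ⟨m, rfl⟩
    rw [hmono]
    refine Subalgebra.list_prod_mem _ ?_
    intro z hz
    obtain ⟨j, -, rfl⟩ := List.mem_map.1 hz
    split_ifs with hji
    · exact Subalgebra.pow_mem _ (hx _ j rfl) _
    · have hj : i ≤ (j : ℕ) := by omega
      cases m.1 j with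
      | ofNat a =>
        simp only [Int.ofNat_eq_natCast, zpow_natCast, Units.val_pow_eq_pow_val]
        rw [hu j hj]
        exact Subalgebra.pow_mem _ (hx _ j rfl) _
      | negSucc a =>
        rw [zpow_negSucc, ← inv_pow, Units.val_pow_eq_pow_val]
        exact Subalgebra.pow_mem _ (hinv j hj) _
  exact htop (Submodule.mem_top (x := y))
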